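/- Fix a real number p > 2 and an integer n ≥ 1, and let φ_n be as defined in the context. Then (φ_n''(r))^{p/(p-2)} ≤ (p(p-1))^{p/(p-2)}·φ_n(r) for every r ∈ ℝ. -/

import Mathlib

/-- The truncated power function `φ_n`: `φ_n(r) = |r|^p` for `|r| < n`, and the second-order
Taylor extension `n^{p-2} (p(p-1)/2)(|r|-n)² + p n^{p-1}(|r|-n) + n^p` for `|r| ≥ n`. -/
noncomputable def phi (p : ℝ) (n : ℕ) (r : ℝ) : ℝ :=
  if |r| < n then |r| ^ p
  else (n : ℝ) ^ (p - 2) * (p * (p - 1) / 2) * (|r| - n) ^ 2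
      + p * (n : ℝ) ^ (p - 1) * (|r| - n) + (n : ℝ) ^ p

/-- Two differentiable branches that agree to first order at `a` glue to a differentiable
function. -/
theorem HasDerivAt.ite_lt {f g : ℝ → ℝ} {f' g' a x : ℝ} (hf : HasDerivAt f f' x)
    (hg : HasDerivAt g g' x) (h : x = a → f x = g x) (h' : x = a → f' = g') :
    HasDerivAt (fun y => if y < a then f y else g y) (if x < a then f' else g') x := by
  rcases lt_trichotomy x a with hx | hx | hx
  · rw [if_pos hx]
    refine hf.congr_of_eventuallyEq ?_
    filter_upwards [eventually_lt_nhds hx] with y hy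
    rw [if_pos hy]
  · rw [if_neg hx.not_lt]
    have h1 : HasDerivWithinAt (fun y => if y < a then f y else g y) g' (Set.Iic x) x := by
      rw [← h' hx]
      refine hf.hasDerivWithinAt.congr (fun y hy => ?_) ?_
      · split_ifs with hya
        · rfl
        · obtain rfl : y = x := le_antisymm hy (hx ▸ not_lt.mp hya)
          exact (h hx).symm
      · rw [if_neg hx.not_lt, h hx]
    have h2 : HasDerivWithinAt (fun y => if y < a then f y else g y) g' (Set.Ici x) x := by
      refine hg.hasDerivWithinAt.congr (fun y hy => ?_) ?_
      · rw [if_neg (not_lt.mpr (hx ▸ hy))]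
      · rw [if_neg hx.not_lt]
    simpa using h1.union h2
  · rw [if_neg hx.not_gt]
    refine hg.congr_of_eventuallyEq ?_
    filter_upwards [eventually_gt_nhds hx] with y hy
    rw [if_neg (not_lt.mpr hy.le)]

theorem phi_neg (p : ℝ) (n : ℕ) (r : ℝ) : phi p n (-r) = phi p n r := by
  simp [phi]

theorem deriv_deriv_phi_neg (p : ℝ) (n : ℕ) (r : ℝ) :
    deriv (deriv (phi p n)) (-r) = deriv (deriv (phi p n)) r := by
  have h1 : ∀ x, deriv (phi p n) (-x) = -deriv (phi p n) x := fun x => by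
    have h := deriv_comp_neg (phi p n) x
    simp only [phi_neg] at h
    linarith
  have h := deriv_comp_neg (deriv (phi p n)) r
  simp only [h1, deriv.fun_neg] at h
  linarith

theorem hasDerivAt_phi_of_pos (p : ℝ) {n : ℕ} {x : ℝ} (hx : 0 < x) :
    HasDerivAt (phi p n) (if x < n then p * x ^ (p - 1)
      else (n : ℝ) ^ (p - 2) * (p * (p - 1)) * (x - n) + p * (n : ℝ) ^ (p - 1)) x := by
  have hf : HasDerivAt (fun y : ℝ => y ^ p) (p * x ^ (p - 1)) x :=
    Real.hasDerivAt_rpow_const (Or.inl hx.ne')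
  have hs : HasDerivAt (fun y : ℝ => y - n) 1 x := (hasDerivAt_id x).sub_const _
  have hg : HasDerivAt (fun y : ℝ => (n : ℝ) ^ (p - 2) * (p * (p - 1) / 2) * (y - n) ^ 2
      + p * (n : ℝ) ^ (p - 1) * (y - n) + (n : ℝ) ^ p)
      ((n : ℝ) ^ (p - 2) * (p * (p - 1)) * (x - n) + p * (n : ℝ) ^ (p - 1)) x := by
    refine ((((hs.fun_pow 2).const_mul ((n : ℝ) ^ (p - 2) * (p * (p - 1) / 2))).fun_add
      (hs.const_mul (p * (n : ℝ) ^ (p - 1)))).add_const ((n : ℝ) ^ p)).congr_deriv ?_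
    push_cast
    ring
  have h := hf.ite_lt hg (a := n) (fun h => by simp [h]) (fun h => by simp [h])
  refine h.congr_of_eventuallyEq ?_
  filter_upwards [eventually_gt_nhds hx] with y hy
  simp only [phi, abs_of_pos hy]

theorem deriv_deriv_phi_of_pos (p : ℝ) {n : ℕ} {x : ℝ} (hx : 0 < x) :
    deriv (deriv (phi p n)) x = p * (p - 1) * min x n ^ (p - 2) := by
  have hf : HasDerivAt (fun y : ℝ => p * y ^ (p - 1)) (p * ((p - 1) * x ^ (p - 1 - 1))) x :=
    (Real.hasDerivAt_rpow_const (Or.inl hx.ne')).const_mul p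
  have hg : HasDerivAt
      (fun y : ℝ => (n : ℝ) ^ (p - 2) * (p * (p - 1)) * (y - n) + p * (n : ℝ) ^ (p - 1))
      ((n : ℝ) ^ (p - 2) * (p * (p - 1))) x := by
    simpa using (((hasDerivAt_id x).sub_const (n : ℝ)).const_mul
      ((n : ℝ) ^ (p - 2) * (p * (p - 1)))).add_const (p * (n : ℝ) ^ (p - 1))
  have he : p - 1 - 1 = p - 2 := by ring
  rw [he] at hf
  have h := hf.ite_lt hg (a := n) (fun h => by simp [h]) (fun h => by rw [h]; ring)
  have hd : deriv (phi p n) =ᶠ[nhds x] _ :=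
    (eventually_gt_nhds hx).mono fun y hy => (hasDerivAt_phi_of_pos p hy).deriv
  rw [hd.deriv_eq, h.deriv]
  split_ifs with hxn
  · rw [min_eq_left hxn.le]; ring
  · rw [min_eq_right (not_lt.mp hxn)]; ring

theorem deriv_deriv_phi_zero {p : ℝ} (hp : 2 < p) {n : ℕ} (hn : 1 ≤ n) :
    deriv (deriv (phi p n)) 0 = 0 := by
  have hn0 : (0 : ℝ) < n := by exact_mod_cast hn
  have hd : deriv (phi p n) =ᶠ[nhds 0] fun x => p * (|x| ^ (p - 2) * x) := by
    have hlt : ∀ᶠ x : ℝ in nhds 0, |x| < n :=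
      continuous_abs.continuousAt.eventually_lt_const (by simpa using hn0)
    filter_upwards [hlt.eventually_nhds] with x hx
    have hx' : phi p n =ᶠ[nhds x] fun y => |y| ^ p := hx.mono fun y hy => by simp [phi, hy]
    rw [hx'.deriv_eq, (hasDerivAt_abs_rpow x (by linarith)).deriv, mul_assoc]
  have h0 : HasDerivAt (fun x : ℝ => |x| ^ (p - 2) * x) 0 0 := by
    rw [hasDerivAt_iff_tendsto_slope]
    have ht : Filter.Tendsto (fun x : ℝ => |x| ^ (p - 2)) (nhdsWithin 0 {0}ᶜ) (nhds 0) := by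
      have hc : Continuous fun x : ℝ => |x| ^ (p - 2) :=
        continuous_abs.rpow_const fun _ => Or.inr (by linarith)
      have := hc.tendsto 0
      rw [abs_zero, Real.zero_rpow (by linarith)] at this
      exact this.mono_left nhdsWithin_le_nhds
    refine ht.congr' ?_
    filter_upwards [self_mem_nhdsWithin] with x hx
    have hx : x ≠ 0 := hx
    simp [slope_def_field, hx]
  rw [hd.deriv_eq, (h0.const_mul p).deriv, mul_zero]

theorem deriv_deriv_phi {p : ℝ} (hp : 2 < p) {n : ℕ} (hn : 1 ≤ n) (r : ℝ) :
    deriv (deriv (phi p n)) r = p * (p - 1) * min |r| n ^ (p - 2) := by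
  rcases lt_trichotomy r 0 with hr | rfl | hr
  · rw [← deriv_deriv_phi_neg, deriv_deriv_phi_of_pos p (neg_pos.mpr hr), abs_of_neg hr]
  · rw [deriv_deriv_phi_zero hp hn, abs_zero, min_eq_left n.cast_nonneg,
      Real.zero_rpow (by linarith), mul_zero]
  · rw [deriv_deriv_phi_of_pos p hr, abs_of_pos hr]

theorem min_abs_rpow_le_phi {p : ℝ} (hp : 1 ≤ p) (n : ℕ) (r : ℝ) :
    min |r| n ^ p ≤ phi p n r := by
  unfold phi
  split_ifs with h
  · rw [min_eq_left h.le]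
  · have h' := not_lt.mp h
    rw [min_eq_right h']
    have h1 : 0 ≤ |r| - n := sub_nonneg.mpr h'
    have h2 : 0 ≤ p - 1 := sub_nonneg.mpr hp
    have h3 : 0 ≤ p := by linarith
    exact le_add_of_nonneg_left (by positivity)

/-- For `p > 2` and `n ≥ 1`,
`(φ_n''(r))^{p/(p-2)} ≤ (p(p-1))^{p/(p-2)} φ_n(r)` for every `r ∈ ℝ`. -/
theorem statement12 (p : ℝ) (hp : 2 < p) (n : ℕ) (hn : 1 ≤ n) (r : ℝ) :
    (deriv (deriv (phi p n)) r) ^ (p / (p - 2))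
      ≤ (p * (p - 1)) ^ (p / (p - 2)) * phi p n r := by
  have hm : 0 ≤ min |r| (n : ℝ) := le_min (abs_nonneg r) n.cast_nonneg
  have hc : 0 ≤ p * (p - 1) := mul_nonneg (by linarith) (by linarith)
  rw [deriv_deriv_phi hp hn, Real.mul_rpow hc (Real.rpow_nonneg hm _), ← Real.rpow_mul hm,
    mul_div_cancel₀ _ (by linarith : p - 2 ≠ 0)]
  exact mul_le_mul_of_nonneg_left (min_abs_rpow_le_phi (by linarith) n r) (Real.rpow_nonneg hc _)
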